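/- arXiv:1911.03027 — 2 statements merged into one kernel-verified Lean document; each statement's English description precedes it below -/
import Mathlib

section
/- Let S be a real m × K matrix, t ∈ ℝ^m, and suppose the polytope Ξ = {ξ ∈ ℝ^K : Sξ ≤ t} is nonempty and bounded. Let Y be a real N × K matrix and θ, y, θ^max ∈ ℝ^N. Then θ + Yξ + y ≤ θ^max (componentwise) holds for all ξ ∈ Ξ if and only if there exists an N × m matrix α with all entries nonnegative such that αS = Y and θ + y + αt ≤ θ^max (componentwise). -/
open Matrix

/-- Farkas' lemma for finitely many linear functionals on a vector space. -/
theorem exists_nonneg_eq_sum_of_forall_nonpos {V : Type*} [AddCommGroup V] [Module ℝ V] (n : ℕ)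
    (A : Fin n → V →ₗ[ℝ] ℝ) (γ : V →ₗ[ℝ] ℝ)
    (h : ∀ x, (∀ i, A i x ≤ 0) → γ x ≤ 0) :
    ∃ u : Fin n → ℝ, (∀ i, 0 ≤ u i) ∧ ∀ x, γ x = ∑ i, u i * A i x := by
  induction n generalizing γ with
  | zero =>
    refine ⟨0, fun i => i.elim0, fun x => ?_⟩
    have h₁ := h x (fun i => i.elim0)
    have h₂ := h (-x) (fun i => i.elim0)
    rw [map_neg] at h₂
    simp only [Finset.univ_eq_empty, Finset.sum_empty]
    linarith
  | succ n ih =>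
    by_cases hγ : ∀ x, (∀ i : Fin n, A i.succ x ≤ 0) → γ x ≤ 0
    · obtain ⟨u, hu, hsum⟩ := ih (fun i => A i.succ) γ hγ
      refine ⟨Fin.cons 0 u, Fin.cases (by simp) (by simpa using hu), fun x => ?_⟩
      simp [Fin.sum_univ_succ, hsum x]
    · push Not at hγ
      obtain ⟨z, hz, hγz⟩ := hγ
      have ha : 0 < A 0 z := by
        by_contra! hle
        exact absurd (h z (Fin.cases hle hz)) (not_le.mpr hγz)
      set a := A 0 z
      obtain ⟨u, hu, hsum⟩ := ih (fun i => A i.succ - (A i.succ z / a) • A 0)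
        (γ - (γ z / a) • A 0) (fun x hx => by
          have key := h (x - (A 0 x / a) • z) (Fin.cases
            (by simp only [map_sub, map_smul, smul_eq_mul]
                rw [div_mul_cancel₀ _ ha.ne', sub_self])
            (fun i => by
              have := hx i
              simp only [LinearMap.sub_apply, LinearMap.smul_apply, map_sub, map_smul,
                smul_eq_mul] at this ⊢
              convert this using 2
              ring))
          simp only [LinearMap.sub_apply, LinearMap.smul_apply, map_sub, map_smul,
            smul_eq_mul] at key ⊢
          convert key using 2
          ring)
      refine ⟨Fin.cons (γ z / a - ∑ i, u i * (A i.succ z / a)) u,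
        Fin.cases ?_ (by simpa using hu), fun x => ?_⟩
      · have hx := hsum x
        simp only [LinearMap.sub_apply, LinearMap.smul_apply, smul_eq_mul, mul_sub,
          Finset.sum_sub_distrib, ← mul_assoc, ← Finset.sum_mul] at hx
        simp only [Fin.sum_univ_succ, Fin.cons_zero, Fin.cons_succ]
        linarith
      · have h₁ : ∑ i, u i * (A i.succ z / a) ≤ 0 := Finset.sum_nonpos fun i _ =>
          mul_nonpos_of_nonneg_of_nonpos (hu i) (div_nonpos_of_nonpos_of_nonneg (hz i) ha.le)
        have h₂ : 0 < γ z / a := div_pos hγz ha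
        simp only [Fin.cons_zero]
        linarith

/-- Affine Farkas lemma: an inequality valid on a nonempty polyhedron is dominated by a
nonnegative combination of the defining inequalities. -/
theorem exists_nonneg_vecMul_eq_of_forall_dotProduct_le {K m : ℕ}
    (S : Matrix (Fin m) (Fin K) ℝ) (t : Fin m → ℝ) (hne : {ξ : Fin K → ℝ | S *ᵥ ξ ≤ t}.Nonempty)
    (c : Fin K → ℝ) (d : ℝ) (h : ∀ ξ, S *ᵥ ξ ≤ t → c ⬝ᵥ ξ ≤ d) :
    ∃ u : Fin m → ℝ, (∀ i, 0 ≤ u i) ∧ u ᵥ* S = c ∧ u ⬝ᵥ t ≤ d := by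
  obtain ⟨ξ₀, hξ₀⟩ := hne
  let F (v : Fin K → ℝ) (r : ℝ) : ((Fin K → ℝ) × ℝ) →ₗ[ℝ] ℝ :=
    (dotProductBilin ℝ ℝ v).comp (LinearMap.fst ℝ _ _) - r • LinearMap.snd ℝ _ _
  have hF : ∀ v r p, F v r p = v ⬝ᵥ p.1 - r * p.2 := fun v r p => rfl
  obtain ⟨u, hu, hsum⟩ := exists_nonneg_eq_sum_of_forall_nonpos (m + 1)
    (Fin.cons (F 0 1) fun i => F (S i) (t i)) (F c d) (by
      rintro ⟨ξ, s⟩ hp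
      have hs : 0 ≤ s := by simpa [hF] using hp 0
      have hS : ∀ i, S i ⬝ᵥ ξ ≤ t i * s := fun i => by simpa [hF] using hp i.succ
      simp only [hF]
      by_contra! hpos
      have key : ∀ r : ℝ, 0 ≤ r → c ⬝ᵥ ξ₀ + r * (c ⬝ᵥ ξ) ≤ d * (1 + r * s) := by
        intro r hr
        have hq : 0 < 1 + r * s := by positivity
        have := h ((1 + r * s)⁻¹ • (ξ₀ + r • ξ)) (fun i => by
          have h₀ : S i ⬝ᵥ ξ₀ ≤ t i := hξ₀ i
          have h₁ := mul_le_mul_of_nonneg_left (hS i) hr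
          change S i ⬝ᵥ _ ≤ t i
          rw [dotProduct_smul, dotProduct_add, dotProduct_smul, smul_eq_mul, smul_eq_mul,
            inv_mul_le_iff₀ hq]
          linarith)
        rw [dotProduct_smul, dotProduct_add, dotProduct_smul, smul_eq_mul, smul_eq_mul,
          inv_mul_le_iff₀ hq] at this
        linarith
      have h₀ := key 0 le_rfl
      have h₁ := key ((d - c ⬝ᵥ ξ₀ + 1) / (c ⬝ᵥ ξ - d * s))
        (div_nonneg (by linarith) hpos.le)
      have h₂ := div_mul_cancel₀ (d - c ⬝ᵥ ξ₀ + 1) hpos.ne'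
      linarith)
  refine ⟨fun i => u i.succ, fun i => hu _, ?_, ?_⟩
  · ext j
    have := hsum (Pi.single j 1, 0)
    simp only [Fin.sum_univ_succ, Fin.cons_zero, Fin.cons_succ, hF, mul_zero, sub_zero,
      dotProduct_single, mul_one, Pi.zero_apply, zero_add] at this
    exact this.symm
  · have := hsum (0, 1)
    simp only [Fin.sum_univ_succ, Fin.cons_zero, Fin.cons_succ, hF, dotProduct_zero, zero_sub,
      mul_one, mul_neg, Finset.sum_neg_distrib] at this
    have h₀ := hu 0
    simp only [dotProduct]
    linarith

/-- LDR dualization of a block of semi-infinite inequalities: for a nonempty bounded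
polytope `Ξ = {ξ : Sξ ≤ t}`, `θ + Yξ + y ≤ θmax` for all `ξ ∈ Ξ` iff there is an
entrywise-nonnegative matrix `α` with `αS = Y` and `θ + y + αt ≤ θmax`. -/
theorem ldr_block_dualization (K m N : ℕ)
    (S : Matrix (Fin m) (Fin K) ℝ) (t : Fin m → ℝ)
    (hne : {ξ : Fin K → ℝ | S.mulVec ξ ≤ t}.Nonempty)
    (hbd : Bornology.IsBounded {ξ : Fin K → ℝ | S.mulVec ξ ≤ t})
    (Y : Matrix (Fin N) (Fin K) ℝ) (θ y θmax : Fin N → ℝ) :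
    (∀ ξ : Fin K → ℝ, S.mulVec ξ ≤ t → θ + Y.mulVec ξ + y ≤ θmax) ↔
      ∃ α : Matrix (Fin N) (Fin m) ℝ,
        (∀ i j, 0 ≤ α i j) ∧ α * S = Y ∧ θ + y + α.mulVec t ≤ θmax := by
  constructor
  · intro h
    choose α hα hαS hαt using fun i => exists_nonneg_vecMul_eq_of_forall_dotProduct_le S t hne
      (Y i) (θmax i - θ i - y i) (fun ξ hξ => by
        have : θ i + Y i ⬝ᵥ ξ + y i ≤ θmax i := h ξ hξ i
        linarith)
    refine ⟨α, hα, funext hαS, fun i => ?_⟩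
    have := hαt i
    change θ i + y i + α i ⬝ᵥ t ≤ θmax i
    linarith
  · rintro ⟨α, hα, rfl, hαt⟩ ξ hξ i
    have h₁ : α i ⬝ᵥ (S *ᵥ ξ) ≤ α i ⬝ᵥ t := dotProduct_le_dotProduct_of_nonneg_left hξ (hα i)
    have h₂ : θ i + y i + α i ⬝ᵥ t ≤ θmax i := hαt i
    rw [← mulVec_mulVec]
    change θ i + α i ⬝ᵥ (S *ᵥ ξ) + y i ≤ θmax i
    linarith
end

section
/- Let b > 0 and Δθ^max > 0, set M = b·Δθ^max, and let z ∈ {0,1}, θ_i, θ_j ∈ ℝ with |θ_i − θ_j| ≤ Δθ^max, and f ∈ ℝ with f^min·z ≤ f ≤ f^max·z for some reals f^min ≤ 0 ≤ f^max. Then the pair of inequalities b(θ_i − θ_j) − f + M(1 − z) ≥ 0 and b(θ_i − θ_j) − f − M(1 − z) ≤ 0 holds if and only if (z = 1 implies f = b(θ_i − θ_j)). -/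
/-- The Big-M constraint pair exactly encodes the DC power-flow equation when the
line is closed and is redundant when it is open. -/
theorem bigM_encoding (b Δθmax M z θi θj f fmin fmax : ℝ)
    (hb : 0 < b) (hΔ : 0 < Δθmax) (hM : M = b * Δθmax)
    (hz : z = 0 ∨ z = 1) (hθ : |θi - θj| ≤ Δθmax)
    (hfmin : fmin ≤ 0) (hfmax : 0 ≤ fmax)
    (hf₁ : fmin * z ≤ f) (hf₂ : f ≤ fmax * z) :
    (b * (θi - θj) - f + M * (1 - z) ≥ 0 ∧ b * (θi - θj) - f - M * (1 - z) ≤ 0) ↔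
      (z = 1 → f = b * (θi - θj)) := by
  obtain ⟨hlo, hhi⟩ := abs_le.mp hθ
  rcases hz with rfl | rfl
  · have hf : f = 0 := by linarith
    have h₁ := mul_le_mul_of_nonneg_left hlo hb.le
    have h₂ := mul_le_mul_of_nonneg_left hhi hb.le
    subst hM hf
    refine iff_of_true ⟨?_, ?_⟩ fun h => absurd h zero_ne_one <;> linarith
  · constructor
    · rintro ⟨h₁, h₂⟩ -
      linarith
    · intro h
      have hf := h rfl
      constructor <;> linarith
end
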